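/- Let F be a finite field with q elements, let V = F^n with standard basis b_1,...,b_n, and let X = (X_1,...,X_k) be a family of subspaces of V such that each X_i is spanned by a subset of the standard basis: X_i = span{b_j : j ∈ L_i} for some L_i ⊆ {1,...,n}. Then there exist a field K containing F and a k × n matrix G over K such that for every k-dimensional subspace U ≤ V and every k × n matrix S over F whose rows form a basis of U, the matrix G·Sᵀ (with S viewed over K) has rank k if and only if U is a q-transversal of X. -/

import Mathlib

/-- `T` is a q-transversal of the family `X` indexed by the finite type `ι`: `T` has
dimension equal to the number of indices, and every (vector-space) basis of `T` admits a
bijective assignment `σ` onto the index set with `b i ∉ X (σ i)` for all `i`. -/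
def IsQTransversal {F V ι : Type*} [Field F] [AddCommGroup V] [Module F V] [Fintype ι]
    (X : ι → Submodule F V) (T : Submodule F V) : Prop :=
  Module.finrank F T = Fintype.card ι ∧
  ∀ (m : ℕ) (b : Fin m → V), LinearIndependent F b → Submodule.span F (Set.range b) = T →
    ∃ σ : Fin m → ι, Function.Bijective σ ∧ ∀ i, b i ∉ X (σ i)


open Submodule in
/-- Rado's theorem for vectors in a finite-dimensional vector space. -/
theorem rado_aux {F E α ι : Type*} [Field F] [AddCommGroup E] [Module F E]
    [FiniteDimensional F E] [DecidableEq α] [Fintype ι] [DecidableEq ι] (v : α → E) :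
    ∀ (N : ℕ) (A : ι → Finset α), ∑ i, (A i).card = N →
    (∀ I : Finset ι, I.card ≤ Module.finrank F (span F (v '' (I.biUnion A : Finset α)))) →
    ∃ f : ι → α, (∀ i, f i ∈ A i) ∧ LinearIndependent F (fun i => v (f i)) := by
  intro N
  induction N using Nat.strong_induction_on with
  | _ N ih =>
  intro A hN hA
  by_cases hbig : ∃ i, 2 ≤ (A i).card
  · obtain ⟨a, ha⟩ := hbig
    obtain ⟨x, hx, y, hy, hxy⟩ := Finset.one_lt_card.mp (show 1 < (A a).card by omega)
    have key : ∀ z ∈ A a,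
        (∀ f : ι → α, (∀ i, f i ∈ A i) → ¬ LinearIndependent F (fun i => v (f i))) →
        ∃ I : Finset ι, a ∉ I ∧ Module.finrank F
          (span F (v '' (((A a).erase z ∪ I.biUnion A : Finset α) : Set α))) ≤ I.card := by
      intro z hz hno
      by_contra hcon
      push Not at hcon
      have hlt : ∑ i, (Function.update A a ((A a).erase z) i).card < N := by
        rw [← hN]
        apply Finset.sum_lt_sum
        · intro i _
          by_cases h : i = a
          · subst h; simpa using Finset.card_le_card (Finset.erase_subset z (A i))
          · simp [Function.update_of_ne h]
        · refine ⟨a, Finset.mem_univ _, ?_⟩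
          simpa using Finset.card_erase_lt_of_mem hz
      obtain ⟨f, hf, hli⟩ := ih _ hlt (Function.update A a ((A a).erase z)) rfl (by
        intro I
        by_cases haI : a ∈ I
        · have h1 := hcon (I.erase a) (Finset.notMem_erase a I)
          rw [Finset.card_erase_of_mem haI] at h1
          have h2 : I.biUnion (Function.update A a ((A a).erase z))
              = (A a).erase z ∪ (I.erase a).biUnion A := by
            conv_lhs => rw [← Finset.insert_erase haI]
            rw [Finset.biUnion_insert, Function.update_self]
            congr 1
            apply Finset.biUnion_congr rfl
            intro i hi
            rw [Function.update_of_ne (Finset.ne_of_mem_erase hi)]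
          rw [h2]
          have := Finset.card_pos.mpr ⟨a, haI⟩
          omega
        · have h2 : I.biUnion (Function.update A a ((A a).erase z)) = I.biUnion A := by
            apply Finset.biUnion_congr rfl
            intro i hi
            rw [Function.update_of_ne (by rintro rfl; exact haI hi)]
          rw [h2]
          exact hA I)
      refine hno f ?_ hli
      intro i
      by_cases h : i = a
      · subst h
        have := hf i
        rw [Function.update_self] at this
        exact Finset.mem_of_mem_erase this
      · have := hf i
        rwa [Function.update_of_ne h] at this
    by_contra hno
    push Not at hno
    obtain ⟨I, haI, hI⟩ := key x hx hno
    obtain ⟨J, haJ, hJ⟩ := key y hy hno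
    have hsm := Submodule.finrank_sup_add_finrank_inf_eq
      (span F (v '' (((A a).erase x ∪ I.biUnion A : Finset α) : Set α)))
      (span F (v '' (((A a).erase y ∪ J.biUnion A : Finset α) : Set α)))
    have h1 := hA (insert a (I ∪ J))
    have h2 := hA (I ∩ J)
    rw [Finset.card_insert_of_notMem (by simp [haI, haJ])] at h1
    have h3 := Finset.card_union_add_card_inter I J
    have h4 : Module.finrank F (span F (v '' ((insert a (I ∪ J)).biUnion A : Finset α))) ≤
      Module.finrank F ((span F (v '' (((A a).erase x ∪ I.biUnion A : Finset α) : Set α)) ⊔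
      (span F (v '' (((A a).erase y ∪ J.biUnion A : Finset α) : Set α))) : Submodule F E)) := by
      apply Submodule.finrank_mono
      rw [← span_union, ← Set.image_union]
      apply span_mono
      apply Set.image_mono
      intro w hw
      simp only [Finset.coe_biUnion, Set.mem_iUnion, Finset.mem_coe, Finset.mem_insert,
        Finset.mem_union, exists_prop] at hw
      simp only [Set.mem_union, Finset.mem_coe, Finset.mem_union, Finset.mem_erase,
        Finset.mem_biUnion]
      obtain ⟨i, rfl | hi | hi, hw⟩ := hw
      · by_cases hwx : w = x
        · subst hwx; exact Or.inr (Or.inl ⟨hxy, hw⟩)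
        · exact Or.inl (Or.inl ⟨hwx, hw⟩)
      · exact Or.inl (Or.inr ⟨i, hi, hw⟩)
      · exact Or.inr (Or.inr ⟨i, hi, hw⟩)
    have h5 : Module.finrank F (span F (v '' ((I ∩ J).biUnion A : Finset α))) ≤
      Module.finrank F ((span F (v '' (((A a).erase x ∪ I.biUnion A : Finset α) : Set α)) ⊓
      (span F (v '' (((A a).erase y ∪ J.biUnion A : Finset α) : Set α))) : Submodule F E)) := by
      apply Submodule.finrank_mono
      refine le_inf ?_ ?_
      all_goals
        apply span_mono
        apply Set.image_mono
        intro w hw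
        simp only [Finset.coe_biUnion, Set.mem_iUnion, Finset.mem_coe, Finset.mem_inter,
          exists_prop] at hw
        obtain ⟨i, hi, hw⟩ := hw
        simp only [Finset.mem_coe, Finset.mem_union, Finset.mem_biUnion]
      · exact Or.inr ⟨i, hi.1, hw⟩
      · exact Or.inr ⟨i, hi.2, hw⟩
    omega
  · push Not at hbig
    have hone : ∀ i, ∃ x, A i = {x} := by
      intro i
      rw [← Finset.card_eq_one]
      have h1 := hA {i}
      have h2 := hbig i
      rcases Nat.eq_zero_or_pos (A i).card with h | h
      · rw [Finset.card_eq_zero] at h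
        simp [h] at h1
      · omega
    choose f hf using hone
    refine ⟨f, fun i => by simp [hf], ?_⟩
    rw [linearIndependent_iff_card_le_finrank_span]
    have h := hA Finset.univ
    have h2 : v '' ((Finset.univ.biUnion A : Finset α) : Set α)
        = Set.range (fun i => v (f i)) := by
      ext w
      simp [hf]
    rw [h2] at h
    exact h

theorem mem_span_single_iff {F : Type*} [Field F] {n : ℕ} (L : Finset (Fin n))
    (v : Fin n → F) :
    v ∈ Submodule.span F ((fun j : Fin n => Pi.single j (1 : F)) '' (L : Set (Fin n))) ↔
      ∀ j, j ∉ L → v j = 0 := by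
  constructor
  · intro hv j hj
    induction hv using Submodule.span_induction with
    | mem x hx =>
      obtain ⟨l, hl, rfl⟩ := hx
      have : j ≠ l := by rintro rfl; exact hj hl
      simp [this]
    | zero => rfl
    | add x y _ _ hx hy => simp [hx, hy]
    | smul a x _ hx => simp [hx]
  · intro h
    have : v = ∑ j, v j • (Pi.single j (1 : F) : Fin n → F) := by
      ext i
      simp [Finset.sum_apply, Pi.single_apply]
    rw [this]
    apply Submodule.sum_mem
    intro j _
    by_cases hj : j ∈ L
    · exact Submodule.smul_mem _ _ (Submodule.subset_span ⟨j, hj, rfl⟩)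
    · simp [h j hj]

theorem rank_eq_iff_det_ne {K : Type*} [Field K] {k : ℕ} (M : Matrix (Fin k) (Fin k) K) :
    M.rank = k ↔ M.det ≠ 0 := by
  constructor
  · intro h h0
    obtain ⟨w, hw, hw0⟩ := Matrix.exists_mulVec_eq_zero_iff.mpr h0
    have h1 := LinearMap.finrank_range_add_finrank_ker M.mulVecLin
    have h2 : Module.finrank K (LinearMap.range M.mulVecLin) = k := h
    rw [h2] at h1
    simp at h1
    apply hw
    have h3 : w ∈ LinearMap.ker M.mulVecLin := by simpa using hw0
    rw [show LinearMap.ker M.mulVecLin = ⊥ by simpa using h1] at h3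
    simpa using h3
  · intro h
    have := Matrix.rank_of_isUnit M ((Matrix.isUnit_iff_isUnit_det M).mpr (isUnit_iff_ne_zero.mpr h))
    simpa using this

theorem range_vecMulLinear' {F : Type*} [Field F] {k n : ℕ} (S : Matrix (Fin k) (Fin n) F) :
    LinearMap.range S.vecMulLinear = Submodule.span F (Set.range (fun i => S i)) := by
  ext w
  rw [LinearMap.mem_range, Submodule.mem_span_range_iff_exists_fun]
  refine exists_congr fun c => ?_
  rw [Matrix.vecMulLinear_apply, Matrix.vecMul_eq_sum]

theorem qt_bad_basis {F : Type*} [Field F] (n k : ℕ) (L : Fin k → Finset (Fin n))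
    (X : Fin k → Submodule F (Fin n → F))
    (hX : ∀ i, X i = Submodule.span F ((fun j : Fin n => Pi.single j (1 : F)) '' (L i)))
    (S : Matrix (Fin k) (Fin n) F)
    (hli : LinearIndependent F (fun i : Fin k => S i))
    (hT : IsQTransversal X (Submodule.span F (Set.range (fun i : Fin k => S i)))) :
    ∃ f : Fin k → Fin n, (∀ i, f i ∉ L i) ∧
      LinearIndependent F (fun i => S.col (f i)) := by
  obtain ⟨f, hf, hfl⟩ := rado_aux (F := F) (fun j => S.col j) _ (fun i => (L i)ᶜ) rfl (by
    intro I
    by_contra hlt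
    push Not at hlt
    set J : Finset (Fin n) := I.biUnion (fun i => (L i)ᶜ) with hJ
    let N : Matrix J (Fin k) F := fun j i => S i j
    have hr : N.rank = Module.finrank F (Submodule.span F ((fun j => S.col j) '' (J : Set (Fin n)))) := by
      rw [Matrix.rank_eq_finrank_span_row]
      have h : Set.range N.row = (fun j => S.col j) '' (J : Set (Fin n)) := by
        rw [Set.image_eq_range]
        rfl
      rw [h]
    have hrk := LinearMap.finrank_range_add_finrank_ker N.mulVecLin
    change N.rank + _ = _ at hrk
    simp only [Module.finrank_fintype_fun_eq_card, Fintype.card_fin] at hrk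
    obtain ⟨Z', hZ⟩ := Submodule.exists_isCompl (LinearMap.ker N.mulVecLin)
    let B := (((Module.finBasis F (LinearMap.ker N.mulVecLin)).prod (Module.finBasis F Z')).map
      (Submodule.prodEquivOfIsCompl _ _ hZ)).reindex finSumFinEquiv
    have hinj : Function.Injective S.vecMulLinear := by
      have := Matrix.vecMul_injective_iff.mpr (show LinearIndependent F S.row from hli)
      exact this
    obtain ⟨σ, hσ, hσX⟩ := hT.2 _ (fun i => S.vecMulLinear (B i))
      (B.linearIndependent.map' _ (LinearMap.ker_eq_bot.mpr hinj)) (by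
        have : Set.range (fun i => S.vecMulLinear (B i)) = S.vecMulLinear '' Set.range B := by
          rw [← Set.range_comp]; rfl
        rw [this, Submodule.span_image, B.span_eq, Submodule.map_top]
        exact range_vecMulLinear' S)
    have hmaps : ∀ d : Fin (Module.finrank F (LinearMap.ker N.mulVecLin)),
        σ (Fin.castAdd _ d) ∈ Iᶜ := by
      intro d
      rw [Finset.mem_compl]
      intro hI
      apply hσX (Fin.castAdd _ d)
      rw [hX, mem_span_single_iff]
      intro j hj
      have hB : B (Fin.castAdd _ d) ∈ LinearMap.ker N.mulVecLin := by
        simp [B, -LinearMap.mem_ker]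
      rw [LinearMap.mem_ker] at hB
      have h0 := congrFun hB ⟨j, Finset.mem_biUnion.mpr ⟨_, hI, by simpa using hj⟩⟩
      refine Eq.trans ?_ h0
      simp [Matrix.vecMul, dotProduct, mul_comm]
      rfl
    have hc := Finset.card_le_card_of_injOn (s := Finset.univ) (t := Iᶜ)
      (fun d => σ (Fin.castAdd _ d)) (fun d _ => hmaps d)
      (fun d _ d' _ h => Fin.castAdd_injective _ _ (hσ.1 h))
    rw [Finset.card_compl] at hc
    simp only [Finset.card_univ, Fintype.card_fin] at hc
    have := Finset.card_le_univ I
    simp only [Fintype.card_fin] at this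
    omega)
  exact ⟨f, fun i => by simpa using hf i, hfl⟩

/-- If every member of the family `X = (X 1, …, X k)` of subspaces of `V = F^n` is spanned
by a subset of the standard basis (`X i = span {b j : j ∈ L i}`), then the associated
q-transversal matroid is representable: there are an extension field `K` of `F` and a
`k × n` matrix `G` over `K` such that for every `k`-dimensional subspace `U ≤ V` and
every matrix `S` whose rows form a basis of `U`, the matrix `G · Sᵀ` has rank `k`
iff `U` is a q-transversal of `X`. -/
theorem qtransversal_representable_aligned {F : Type} [Field F] [Fintype F]
    (n k : ℕ) (L : Fin k → Finset (Fin n))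
    (X : Fin k → Submodule F (Fin n → F))
    (hX : ∀ i, X i = Submodule.span F ((fun j : Fin n => Pi.single j (1 : F)) '' (L i))) :
    ∃ (K : Type) (_ : Field K) (_ : Algebra F K) (G : Matrix (Fin k) (Fin n) K),
      ∀ (U : Submodule F (Fin n → F)) (S : Matrix (Fin k) (Fin n) F),
        Module.finrank F U = k →
        LinearIndependent F (fun i : Fin k => S i) →
        Submodule.span F (Set.range (fun i : Fin k => S i)) = U →
        ((G * (S.map (algebraMap F K)).transpose).rank = k ↔ IsQTransversal X U) := by
  classical
  let R := MvPolynomial (Fin k × Fin n) F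
  let P : Matrix (Fin k) (Fin n) R :=
    fun i j => if j ∈ L i then 0 else MvPolynomial.X (i, j)
  refine ⟨FractionRing R, inferInstance, inferInstance, P.map (algebraMap R _), ?_⟩
  intro U S hU hli hspan
  subst hspan
  have hmap : ∀ B : Matrix (Fin k) (Fin n) F,
      P.map (algebraMap R (FractionRing R)) * (B.map (algebraMap F (FractionRing R))).transpose
      = (P * (B.map (algebraMap F R)).transpose).map (algebraMap R (FractionRing R)) := by
    intro B
    rw [Matrix.map_mul, Matrix.transpose_map, Matrix.map_map]
    congr 2
  rw [rank_eq_iff_det_ne, hmap, ← RingHom.mapMatrix_apply, ← RingHom.map_det, Ne,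
    FaithfulSMul.algebraMap_eq_zero_iff]
  constructor
  · intro hdet
    refine ⟨by simpa using hU, ?_⟩
    intro m b hb hbs
    have hm : m = k := by
      have := finrank_span_eq_card hb
      rw [hbs, hU] at this
      simpa using this.symm
    subst hm
    have hD : ∀ i, ∃ c : Fin m → F, ∑ j, c j • b j = S i := by
      intro i
      rw [← Submodule.mem_span_range_iff_exists_fun, hbs]
      exact Submodule.subset_span ⟨i, rfl⟩
    choose D hD using hD
    have hS : S = Matrix.of D * Matrix.of b := by
      ext i j
      rw [← hD i]
      simp [Matrix.mul_apply]
    rw [hS, Matrix.map_mul, Matrix.transpose_mul, ← Matrix.mul_assoc, Matrix.det_mul] at hdet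
    have h1 := left_ne_zero_of_mul hdet
    rw [Matrix.det_apply] at h1
    obtain ⟨σ, _, hσ⟩ := Finset.exists_ne_zero_of_sum_ne_zero h1
    refine ⟨σ, σ.bijective, ?_⟩
    intro i hi
    rw [hX, mem_span_single_iff] at hi
    apply hσ
    rw [Finset.prod_eq_zero (Finset.mem_univ i), smul_zero]
    rw [Matrix.mul_apply]
    apply Finset.sum_eq_zero
    intro j _
    by_cases hj : j ∈ L (σ i)
    · simp [P, hj]
    · simp [hi j hj]
  · intro hT hdet
    obtain ⟨f, hf, hfl⟩ := qt_bad_basis n k L X hX S hli hT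
    let φ : R →+* F := MvPolynomial.eval (fun p => if p.2 = f p.1 then 1 else 0)
    have h1 := congrArg φ hdet
    rw [RingHom.map_det, map_zero] at h1
    have h2 : φ.mapMatrix (P * (S.map (algebraMap F R)).transpose)
        = Matrix.of (fun i => S.col (f i)) := by
      ext i l
      simp only [RingHom.mapMatrix_apply, Matrix.map_apply, Matrix.mul_apply, map_sum, map_mul,
        Matrix.transpose_apply, Matrix.of_apply, Matrix.col_apply]
      rw [Finset.sum_eq_single (f i)]
      · simp [P, hf i, φ, R, MvPolynomial.algebraMap_eq]
      · intro j _ hj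
        by_cases hjL : j ∈ L i
        · simp [P, hjL]
        · have : φ (MvPolynomial.X (i, j)) = 0 := by
            rw [show φ (MvPolynomial.X (i, j)) = _ from MvPolynomial.eval_X _]
            simp [hj]
          simp [P, hjL, this]
      · simp
    rw [h2] at h1
    have h3 := Matrix.linearIndependent_rows_iff_isUnit.mp
      (show LinearIndependent F (Matrix.of (fun i => S.col (f i))).row from hfl)
    rw [Matrix.isUnit_iff_isUnit_det, h1] at h3
    simp at h3
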